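/- For every integer n ≥ 37 with n ≡ 1 (mod 12), there exists a sequence of flips of length exactly (3n+3)/2 that transforms the burnt stack Ī_n = [-1, -2, ..., -n] into the sorted stack I_n = [1, 2, ..., n]. -/

import Mathlib

/-- The flip of the top `k` pancakes of a burnt pancake stack `l`. -/
def pancakeFlip (k : ℕ) (l : List ℤ) : List ℤ :=
  ((l.take k).map Neg.neg).reverse ++ l.drop k

/-- Apply a sequence of flips (given by their sizes) successively to a stack. -/
def applyFlips (ks : List ℕ) (l : List ℤ) : List ℤ :=
  ks.foldl (fun s k => pancakeFlip k s) l

/-- The sorted stack `I_n = [1, 2, ..., n]`. -/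
def sortedStack (n : ℕ) : List ℤ := (List.range n).map (fun i => (i : ℤ) + 1)

/-- The reversed burnt stack `Ī_n = [-1, -2, ..., -n]`. -/
def burntStack (n : ℕ) : List ℤ := (List.range n).map (fun i => -((i : ℤ) + 1))

/-- A sequence of flips, each of size between `1` and `n`, transforming `Ī_n` into `I_n`. -/
def IsSortingSeq (n : ℕ) (ks : List ℕ) : Prop :=
  (∀ k ∈ ks, 1 ≤ k ∧ k ≤ n) ∧ applyFlips ks (burntStack n) = sortedStack n

/-- `T n` is the minimum number of flips transforming `Ī_n` into `I_n`. -/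
noncomputable def T (n : ℕ) : ℕ :=
  sInf {m | ∃ ks : List ℕ, IsSortingSeq n ks ∧ ks.length = m}

/-- The image of a stack segment under a flip: reversed, with all burnt sides exchanged. -/
def flipped (l : List ℤ) : List ℤ := (l.map Neg.neg).reverse

@[simp] theorem flipped_nil : flipped [] = [] := rfl

@[simp] theorem flipped_cons (a : ℤ) (l : List ℤ) : flipped (a :: l) = flipped l ++ [-a] := by
  simp [flipped]

@[simp] theorem flipped_append (l m : List ℤ) : flipped (l ++ m) = flipped m ++ flipped l := by
  simp [flipped]

@[simp] theorem flipped_flipped (l : List ℤ) : flipped (flipped l) = l := by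
  simp [flipped]

@[simp] theorem length_flipped (l : List ℤ) : (flipped l).length = l.length := by
  simp [flipped]

@[simp] theorem applyFlips_nil (l : List ℤ) : applyFlips [] l = l := rfl

theorem applyFlips_append (ks js : List ℕ) (l : List ℤ) :
    applyFlips (ks ++ js) l = applyFlips js (applyFlips ks l) := by
  simp [applyFlips]

theorem applyFlips_step {k : ℕ} {ks : List ℕ} {l l' : List ℤ} (X Y : List ℤ) (hl : l = X ++ Y)
    (hk : X.length = k) (h : applyFlips ks (flipped X ++ Y) = l') :
    applyFlips (k :: ks) l = l' := by
  subst hl hk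
  simpa [applyFlips, pancakeFlip, flipped] using h

theorem length_flatMap_range' (F : ℕ → List ℤ) (p : ℕ) (hF : ∀ j, (F j).length = p) (i m : ℕ) :
    ((List.range' i m).flatMap F).length = p * m := by
  induction m generalizing i with
  | zero => simp
  | succ m ih => simp [List.range'_succ, hF, ih]; ring

theorem applyFlips_interleave (C W : List ℤ) (a b d e : ℕ → ℤ) (c m i : ℕ) (Z : List ℤ)
    (hZ : Z.length = 4 * i) (hc : C.length + 2 * (i + m) = c + 2) :
    applyFlips ((List.range' i m).flatMap fun j => [c + 2 * j + 2, c + 2 * j])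
      ((List.range' i m).flatMap (fun j => [a j, b j]) ++ C ++ Z ++
        (List.range' i m).flatMap (fun j => [d j, e j]) ++ W) =
      C ++ Z ++ (List.range' i m).flatMap (fun j => [-b j, -a j, d j, e j]) ++ W := by
  induction m generalizing i Z with
  | zero => simp
  | succ m ih =>
    have hr := length_flatMap_range' (fun j => [a j, b j]) 2 (by simp) (i + 1) m
    have := ih (i + 1) (Z ++ [-b i, -a i, d i, e i]) (by simp [hZ]; ring) (by omega)
    simp only [List.range'_succ, List.flatMap_cons, List.cons_append, List.nil_append]
    refine applyFlips_step ([a i, b i] ++ (List.range' (i + 1) m).flatMap (fun j => [a j, b j]) ++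
      C ++ Z) ([d i, e i] ++ (List.range' (i + 1) m).flatMap (fun j => [d j, e j]) ++ W)
      (by simp) (by simp [hr, hZ]; omega) ?_
    refine applyFlips_step (flipped ((List.range' (i + 1) m).flatMap (fun j => [a j, b j]) ++ C ++ Z))
      ([-b i, -a i, d i, e i] ++ (List.range' (i + 1) m).flatMap (fun j => [d j, e j]) ++ W)
      (by simp) (by simp [hr, hZ]; omega) ?_
    simpa using this

/-- The top part of the stack after the prefix `Q` has successively absorbed the blocks
`F i`, ..., `F (i + m - 1)`, being flipped before each of them. -/
def nest (F : ℕ → List ℤ) : ℕ → ℕ → List ℤ → List ℤ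
  | _, 0, Q => Q
  | i, m + 1, Q => nest F (i + 1) m (flipped Q ++ F i)

theorem length_nest (F : ℕ → List ℤ) (hF : ∀ j, (F j).length = 4) (i m : ℕ) (Q : List ℤ) :
    (nest F i m Q).length = Q.length + 4 * m := by
  induction m generalizing i Q with
  | zero => simp [nest]
  | succ m ih => simp [nest, ih, hF]; ring

theorem applyFlips_nest (F : ℕ → List ℤ) (hF : ∀ j, (F j).length = 4) (W : List ℤ) (c i m : ℕ)
    (Q : List ℤ) (hQ : Q.length = c + 4 * i) :
    applyFlips ((List.range' i m).map fun j => c + 4 * j)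
      (Q ++ (List.range' i m).flatMap F ++ W) = nest F i m Q ++ W := by
  induction m generalizing i Q with
  | zero => simp [nest]
  | succ m ih =>
    have := ih (i + 1) (flipped Q ++ F i) (by simp [hF, hQ]; ring)
    simp only [List.range'_succ, List.map_cons, List.flatMap_cons, nest]
    refine applyFlips_step Q (F i ++ (List.range' (i + 1) m).flatMap F ++ W) (by simp) hQ ?_
    simpa using this

theorem applyFlips_unnest (f g h z : ℕ → ℤ) (W : List ℤ) (c i m : ℕ) (Q : List ℤ)
    (hQ : Q.length = c + 4 * i) :
    applyFlips ((List.range' i m).map fun j => c + 4 * j + 4).reverse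
      ([-g (i + m), -f (i + m)] ++ nest (fun j => [f j, g j, h j, z j]) i m Q ++ W) =
      [-g i, -f i] ++ Q ++
        (List.range' i m).flatMap (fun j => [f (j + 1), g (j + 1), h j, z j]) ++ W := by
  induction m generalizing i Q with
  | zero => simp [nest]
  | succ m ih =>
    have := ih (i + 1) (flipped Q ++ [f i, g i, h i, z i]) (by simp [hQ]; ring)
    rw [List.range'_succ, List.map_cons, List.reverse_cons, applyFlips_append, nest,
      show i + (m + 1) = i + 1 + m by ring, this]
    refine applyFlips_step ([-g (i + 1), -f (i + 1)] ++ flipped Q ++ [f i, g i])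
      ([h i, z i] ++ (List.range' (i + 1) m).flatMap
        (fun j => [f (j + 1), g (j + 1), h j, z j]) ++ W) (by simp) (by simp [hQ]) ?_
    simp

theorem applyFlips_unzip (a b y z : ℕ → ℤ) (c m : ℕ) (H W : List ℤ)
    (hH : H.length + 2 * m = c + 2) :
    applyFlips ((List.range m).reverse.flatMap fun j => [c + 2 * j, c + 2 * j + 2])
      (H ++ (List.range m).flatMap (fun j => [a j, b j, y j, z j]) ++ W) =
      (List.range m).flatMap (fun j => [-b j, -a j]) ++ H ++
        (List.range m).flatMap (fun j => [y j, z j]) ++ W := by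
  induction m generalizing H W with
  | zero => simp
  | succ m ih =>
    have hr := length_flatMap_range' (fun j => [a j, b j, y j, z j]) 4 (by simp) 0 m
    rw [← List.range_eq_range'] at hr
    have := ih ([-b m, -a m] ++ H) ([y m, z m] ++ W) (by simp; omega)
    simp only [List.range_succ, List.reverse_append, List.reverse_singleton, List.flatMap_append,
      List.flatMap_singleton, List.cons_append, List.nil_append]
    refine applyFlips_step (H ++ (List.range m).flatMap (fun j => [a j, b j, y j, z j]))
      ([a m, b m, y m, z m] ++ W) (by simp) (by simp [hr]; omega) ?_
    refine applyFlips_step (flipped (H ++ (List.range m).flatMap (fun j => [a j, b j, y j, z j])) ++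
      [a m, b m]) ([y m, z m] ++ W) (by simp) (by simp [hr]; omega) ?_
    simpa [List.flatMap] using this

theorem cut_blocks (t : ℕ) (c1 c2 c3 c4 c5 c6 c7 c8 c9 c10 c11 c12 c13 c14 c15 c16 c17 c18 c19 p q :
    ℤ)
    (Z : List ℤ) (hZ : Z.length = 4 * t) :
    applyFlips [4 * t + 19, 4 * t + 11, 4 * t + 15, 4 * t + 11, 3, 5]
      ([-c1, -c2, -c3, -c4, -c5, -c6, -c7, -c8, -c9, -c10, -c11, -c12, -c13, -c14, -c15, -c16, -c17,
        -c18, -c19] ++ Z ++ [-p, -q]) =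
      [c17, c16, -c13, -c14, -c15, -c18, -c19] ++ Z ++ [c8, c7, c6, c5, c12, c11, c10, c9, c4, c3,
        c2, c1, -p, -q] := by
  refine applyFlips_step ([-c1, -c2, -c3, -c4, -c5, -c6, -c7, -c8, -c9, -c10, -c11, -c12, -c13,
    -c14, -c15, -c16, -c17, -c18, -c19] ++ Z)
    ([-p, -q]) (by simp) (by simp [hZ]) ?_
  refine applyFlips_step (flipped Z ++ [c19, c18, c17, c16, c15, c14, c13, c12, c11, c10, c9])
    ([c8, c7, c6, c5, c4, c3, c2, c1, -p, -q]) (by simp) (by simp [hZ]) ?_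
  refine applyFlips_step ([-c9, -c10, -c11, -c12, -c13, -c14, -c15, -c16, -c17, -c18, -c19] ++ Z ++
    [c8, c7, c6, c5])
    ([c4, c3, c2, c1, -p, -q]) (by simp) (by simp [hZ]) ?_
  refine applyFlips_step ([-c5, -c6, -c7, -c8] ++ flipped Z ++ [c19, c18, c17, c16, c15, c14, c13])
    ([c12, c11, c10, c9, c4, c3, c2, c1, -p, -q]) (by simp) (by simp [hZ]) ?_
  refine applyFlips_step ([-c13, -c14, -c15])
    ([-c16, -c17, -c18, -c19] ++ Z ++ [c8, c7, c6, c5, c12, c11, c10, c9, c4, c3, c2, c1, -p, -q])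
      (by simp) rfl ?_
  refine applyFlips_step ([c15, c14, c13, -c16, -c17])
    ([-c18, -c19] ++ Z ++ [c8, c7, c6, c5, c12, c11, c10, c9, c4, c3, c2, c1, -p, -q]) (by simp) rfl
      ?_
  simp

theorem move_nest (t : ℕ) (c7 c6 c5 c12 c11 c10 c9 c4 c3 c2 c1 p q : ℤ)
    (N : List ℤ) (hN : N.length = 4 * t + 8) :
    applyFlips [4 * t + 18, 4, 10, 4 * t + 20]
      (N ++ [c7, c6, c5, c12, c11, c10, c9, c4, c3, c2, c1, -p, -q]) =
      [p, -c1] ++ N ++ [c9, c4, c3, c2, -c10, -c11, -c12, -c5, -c6, -c7, -q] := by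
  refine applyFlips_step (N ++ [c7, c6, c5, c12, c11, c10, c9, c4, c3, c2])
    ([c1, -p, -q]) (by simp) (by simp [hN]) ?_
  refine applyFlips_step ([-c2, -c3, -c4, -c9])
    ([-c10, -c11, -c12, -c5, -c6, -c7] ++ flipped N ++ [c1, -p, -q]) (by simp) rfl ?_
  refine applyFlips_step ([c9, c4, c3, c2, -c10, -c11, -c12, -c5, -c6, -c7])
    (flipped N ++ [c1, -p, -q]) (by simp) rfl ?_
  refine applyFlips_step ([c7, c6, c5, c12, c11, c10, -c2, -c3, -c4, -c9] ++ flipped N ++ [c1, -p])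
    ([-q]) (by simp) (by simp [hN]) ?_
  simp

theorem sweep_front (s o c17 c16 c13 c14 c15 c18 c19 c8 c9 c4 c3 c2 c10 c11 c12 c5 c6 c7 q : ℤ)
    (V : List ℤ) :
    applyFlips [8, 5, 3]
      ([s, -o, c17, c16, -c13, -c14, -c15, -c18, -c19] ++ V ++ [c8, c9, c4, c3, c2, -c10, -c11,
        -c12, -c5, -c6, -c7, -q]) =
      [c14, c13, -c16, -c15, -c18, -c17, o, -s, -c19] ++ V ++ [c8, c9, c4, c3, c2, -c10, -c11, -c12,
        -c5, -c6, -c7, -q] := by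
  refine applyFlips_step ([s, -o, c17, c16, -c13, -c14, -c15, -c18])
    ([-c19] ++ V ++ [c8, c9, c4, c3, c2, -c10, -c11, -c12, -c5, -c6, -c7, -q]) (by simp) rfl ?_
  refine applyFlips_step ([c18, c15, c14, c13, -c16])
    ([-c17, o, -s, -c19] ++ V ++ [c8, c9, c4, c3, c2, -c10, -c11, -c12, -c5, -c6, -c7, -q])
      (by simp) rfl ?_
  refine applyFlips_step ([c16, -c13, -c14])
    ([-c15, -c18, -c17, o, -s, -c19] ++ V ++ [c8, c9, c4, c3, c2, -c10, -c11, -c12, -c5, -c6, -c7,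
      -q]) (by simp) rfl ?_
  simp

theorem gather_ends (t : ℕ) (c14 c13 c16 c15 c18 c17 o p e c8 c9 c4 c3 c2 c10 c11 c12 c5 c6 c7 q :
    ℤ)
    (V : List ℤ) (hV : V.length = 4 * t) :
    applyFlips [4 * t + 15, 4 * t + 21, 4 * t + 13, 4 * t + 19, 8, 4]
      ([c14, c13, -c16, -c15, -c18, -c17, o] ++ V ++ [-p, -e, c8, c9, c4, c3, c2, -c10, -c11, -c12,
        -c5, -c6, -c7, -q]) =
      [e, p, q, c7, c8, c9, c4, c3, c6, c5, c12, c11, c14, c13, -c16, -c15, -c18, -c17, o] ++ V ++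
        [c2, -c10] := by
  refine applyFlips_step ([c14, c13, -c16, -c15, -c18, -c17, o] ++ V ++ [-p, -e, c8, c9, c4, c3, c2,
    -c10])
    ([-c11, -c12, -c5, -c6, -c7, -q]) (by simp) (by simp [hV]) ?_
  refine applyFlips_step ([c10, -c2, -c3, -c4, -c9, -c8, e, p] ++ flipped V ++ [-o, c17, c18, c15,
    c16, -c13, -c14, -c11, -c12, -c5, -c6, -c7, -q])
    ([]) (by simp) (by simp [hV]) ?_
  refine applyFlips_step ([q, c7, c6, c5, c12, c11, c14, c13, -c16, -c15, -c18, -c17, o] ++ V)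
    ([-p, -e, c8, c9, c4, c3, c2, -c10]) (by simp) (by simp [hV]) ?_
  refine applyFlips_step (flipped V ++ [-o, c17, c18, c15, c16, -c13, -c14, -c11, -c12, -c5, -c6,
    -c7, -q, -p, -e, c8, c9, c4, c3])
    ([c2, -c10]) (by simp) (by simp [hV]) ?_
  refine applyFlips_step ([-c3, -c4, -c9, -c8, e, p, q, c7])
    ([c6, c5, c12, c11, c14, c13, -c16, -c15, -c18, -c17, o] ++ V ++ [c2, -c10]) (by simp) rfl ?_
  refine applyFlips_step ([-c7, -q, -p, -e])
    ([c8, c9, c4, c3, c6, c5, c12, c11, c14, c13, -c16, -c15, -c18, -c17, o] ++ V ++ [c2, -c10])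
      (by simp) rfl ?_
  simp

theorem merge_blocks (t : ℕ) (e p q c7 c8 c9 c4 c3 c6 c5 c12 c11 c14 c13 c16 c15 c18 c17 o c2 c10 :
    ℤ)
    (F E : List ℤ) (hF : F.length = 2 * t) (hE : E.length = 2 * t) :
    applyFlips [2 * t + 16, 3, 5, 4 * t + 20, 4 * t + 11, 4 * t + 13, 4 * t + 9, 4 * t + 21, 9, 13,
      11, 5, 3, 2 * t + 16]
      (F ++ [e, p, q, c7, c8, c9, c4, c3, c6, c5, c12, c11, c14, c13, -c16, -c15, -c18, -c17, o] ++
        E ++ [c2, -c10]) =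
      [o] ++ E ++ [c2, c3, c4, c5, c6, c7, c8, c9, c10, c11, c12, c13, c14, c15, c16, c17, c18] ++ F
        ++ [e, p, q] := by
  refine applyFlips_step (F ++ [e, p, q, c7, c8, c9, c4, c3, c6, c5, c12, c11, c14, c13, -c16,
    -c15])
    ([-c18, -c17, o] ++ E ++ [c2, -c10]) (by simp) (by simp [hF]) ?_
  refine applyFlips_step ([c15, c16, -c13])
    ([-c14, -c11, -c12, -c5, -c6, -c3, -c4, -c9, -c8, -c7, -q, -p, -e] ++ flipped F ++ [-c18, -c17,
      o] ++ E ++ [c2, -c10]) (by simp) rfl ?_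
  refine applyFlips_step ([c13, -c16, -c15, -c14, -c11])
    ([-c12, -c5, -c6, -c3, -c4, -c9, -c8, -c7, -q, -p, -e] ++ flipped F ++ [-c18, -c17, o] ++ E ++
      [c2, -c10]) (by simp) rfl ?_
  refine applyFlips_step ([c11, c14, c15, c16, -c13, -c12, -c5, -c6, -c3, -c4, -c9, -c8, -c7, -q,
    -p, -e] ++ flipped F ++ [-c18, -c17, o] ++ E ++ [c2])
    ([-c10]) (by simp) (by simp [hF, hE]; omega) ?_
  refine applyFlips_step ([-c2] ++ flipped E ++ [-o, c17, c18] ++ F ++ [e, p, q, c7, c8, c9, c4])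
    ([c3, c6, c5, c12, c13, -c16, -c15, -c14, -c11, -c10]) (by simp) (by simp [hE, hF]; omega) ?_
  refine applyFlips_step ([-c4, -c9, -c8, -c7, -q, -p, -e] ++ flipped F ++ [-c18, -c17, o] ++ E ++
    [c2, c3, c6])
    ([c5, c12, c13, -c16, -c15, -c14, -c11, -c10]) (by simp) (by simp [hF, hE]; omega) ?_
  refine applyFlips_step ([-c6, -c3, -c2] ++ flipped E ++ [-o, c17, c18] ++ F ++ [e, p, q])
    ([c7, c8, c9, c4, c5, c12, c13, -c16, -c15, -c14, -c11, -c10]) (by simp)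
      (by simp [hE, hF]; omega) ?_
  refine applyFlips_step ([-q, -p, -e] ++ flipped F ++ [-c18, -c17, o] ++ E ++ [c2, c3, c6, c7, c8,
    c9, c4, c5, c12, c13, -c16, -c15, -c14, -c11, -c10])
    ([]) (by simp) (by simp [hF, hE]; omega) ?_
  refine applyFlips_step ([c10, c11, c14, c15, c16, -c13, -c12, -c5, -c4])
    ([-c9, -c8, -c7, -c6, -c3, -c2] ++ flipped E ++ [-o, c17, c18] ++ F ++ [e, p, q]) (by simp) rfl
      ?_
  refine applyFlips_step ([c4, c5, c12, c13, -c16, -c15, -c14, -c11, -c10, -c9, -c8, -c7, -c6])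
    ([-c3, -c2] ++ flipped E ++ [-o, c17, c18] ++ F ++ [e, p, q]) (by simp) rfl ?_
  refine applyFlips_step ([c6, c7, c8, c9, c10, c11, c14, c15, c16, -c13, -c12])
    ([-c5, -c4, -c3, -c2] ++ flipped E ++ [-o, c17, c18] ++ F ++ [e, p, q]) (by simp) rfl ?_
  refine applyFlips_step ([c12, c13, -c16, -c15, -c14])
    ([-c11, -c10, -c9, -c8, -c7, -c6, -c5, -c4, -c3, -c2] ++ flipped E ++ [-o, c17, c18] ++ F ++ [e,
      p, q]) (by simp) rfl ?_
  refine applyFlips_step ([c14, c15, c16])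
    ([-c13, -c12, -c11, -c10, -c9, -c8, -c7, -c6, -c5, -c4, -c3, -c2] ++ flipped E ++ [-o, c17, c18]
      ++ F ++ [e, p, q]) (by simp) rfl ?_
  refine applyFlips_step ([-c16, -c15, -c14, -c13, -c12, -c11, -c10, -c9, -c8, -c7, -c6, -c5, -c4,
    -c3, -c2] ++ flipped E ++ [-o])
    ([c17, c18] ++ F ++ [e, p, q]) (by simp) (by simp [hE]) ?_
  simp

theorem flatMap_range_rotate (x w : ℕ → List ℤ) (m : ℕ) (W : List ℤ) :
    (List.range m).flatMap (fun j => x j ++ w j) ++ (x m ++ W) =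
      x 0 ++ ((List.range m).flatMap (fun j => w j ++ x (j + 1)) ++ W) := by
  induction m generalizing W with
  | zero => simp
  | succ m ih =>
    have := ih (w m ++ (x (m + 1) ++ W))
    simpa [List.range_succ] using this

theorem map_range_two_mul (F : ℕ → ℤ) (m : ℕ) :
    (List.range (2 * m)).map F = (List.range m).flatMap fun j => [F (2 * j), F (2 * j + 1)] := by
  induction m with
  | zero => simp
  | succ m ih => simp [mul_add, List.range_succ, ih]

theorem flatMap_range_congr {F G : ℕ → List ℤ} {m : ℕ} (h : ∀ j < m, F j = G j) :
    (List.range m).flatMap F = (List.range m).flatMap G :=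
  List.flatMap_congr fun j hj => h j (List.mem_range.1 hj)

theorem burntStack_eq_map (n : ℕ) :
    burntStack n = (List.range n).map fun i : ℕ => -((i : ℤ) + 1) := by
  simp [burntStack, List.map_eq_flatMap, List.flatMap_assoc]

theorem sortedStack_eq_map (n : ℕ) :
    sortedStack n = (List.range n).map fun i : ℕ => (i : ℤ) + 1 := by
  simp [sortedStack, List.map_eq_flatMap, List.flatMap_assoc]

theorem burntStack_eq (t : ℕ) :
    burntStack (21 + 4 * t) =
      (List.range t).flatMap (fun j : ℕ => [-(2 * j + 1 : ℤ), -(2 * j + 2 : ℤ)]) ++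
        (List.range 19).map (fun j : ℕ => -(2 * t + (j + 1) : ℤ)) ++
        (List.range t).flatMap (fun j : ℕ => [-(20 + 2 * t + 2 * j : ℤ), -(21 + 2 * t + 2 * j : ℤ)])
        ++ [-(20 + 4 * t : ℤ), -(21 + 4 * t : ℤ)] := by
  rw [show 21 + 4 * t = 2 * t + 19 + 2 * t + 2 by ring, burntStack_eq_map]
  simp only [List.range_add, List.map_append, map_range_two_mul, List.map_map]
  refine congrArg₂ _ (congrArg₂ _ (congrArg₂ _ ?_ ?_) ?_) ?_
  · exact flatMap_range_congr fun j _ => by push_cast; ring_nf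
  · exact List.map_congr_left fun j _ => by simp; ring
  · exact flatMap_range_congr fun j _ => by simp; constructor <;> ring
  · simp [List.range_succ]; constructor <;> ring

theorem sortedStack_eq (t : ℕ) :
    sortedStack (21 + 4 * t) =
      [1] ++ (List.range t).flatMap (fun j : ℕ => [(2 * j + 2 : ℤ), (2 * j + 3 : ℤ)]) ++
        (List.range 17).map (fun j : ℕ => (2 * t + (j + 2) : ℤ)) ++
        (List.range t).flatMap (fun j : ℕ => [(19 + 2 * t + 2 * j : ℤ), (20 + 2 * t + 2 * j : ℤ)])
        ++ [(19 + 4 * t : ℤ), (20 + 4 * t : ℤ), (21 + 4 * t : ℤ)] := by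
  rw [show 21 + 4 * t = 1 + 2 * t + 17 + 2 * t + 3 by ring, sortedStack_eq_map]
  simp only [List.range_add, List.map_append, map_range_two_mul, List.map_map]
  refine congrArg₂ _ (congrArg₂ _ (congrArg₂ _ (congrArg₂ _ ?_ ?_) ?_) ?_) ?_
  · simp
  · exact flatMap_range_congr fun j _ => by simp; constructor <;> ring
  · exact List.map_congr_left fun j _ => by simp; ring
  · exact flatMap_range_congr fun j _ => by simp; constructor <;> ring
  · simp [List.range_succ]; refine ⟨?_, ?_, ?_⟩ <;> ring

/-- A sequence of flips sorting the burnt stack of size `21 + 4 * t`. -/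
def sortingWord (t : ℕ) : List ℕ :=
  ((List.range t).flatMap fun j => [2 * t + 17 + 2 * j + 2, 2 * t + 17 + 2 * j]) ++
    ([4 * t + 19, 4 * t + 11, 4 * t + 15, 4 * t + 11, 3, 5] ++
    (((List.range t).map fun j => 8 + 4 * j) ++
    ([4 * t + 18, 4, 10, 4 * t + 20] ++
    (((List.range t).map fun j => 8 + 4 * j + 4).reverse ++
    ([8, 5, 3] ++
    ([4 * t + 15, 4 * t + 21, 4 * t + 13, 4 * t + 19, 8, 4] ++
    (((List.range t).reverse.flatMap fun j => [2 * t + 17 + 2 * j, 2 * t + 17 + 2 * j + 2]) ++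
    [2 * t + 16, 3, 5, 4 * t + 20, 4 * t + 11, 4 * t + 13, 4 * t + 9, 4 * t + 21, 9, 13, 11, 5, 3,
      2 * t + 16])))))))

theorem length_sortingWord (t : ℕ) : (sortingWord t).length = 33 + 6 * t := by
  simp [sortingWord]
  ring

theorem mem_sortingWord {t k : ℕ} (hk : k ∈ sortingWord t) : 1 ≤ k ∧ k ≤ 21 + 4 * t := by
  simp only [sortingWord, List.mem_append, List.mem_flatMap, List.mem_map, List.mem_reverse,
    List.mem_range, List.mem_cons, List.not_mem_nil, or_false] at hk
  rcases hk with ⟨a, ha, hk⟩ | hk | ⟨a, ha, hk⟩ | hk | ⟨a, ha, hk⟩ | hk | hk | ⟨a, ha, hk⟩ | hk <;>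
    omega

theorem length_flatMap_range (F : ℕ → List ℤ) (p : ℕ) (hF : ∀ j, (F j).length = p) (m : ℕ) :
    ((List.range m).flatMap F).length = p * m := by
  rw [List.range_eq_range', length_flatMap_range' F p hF]

theorem applyFlips_sortingWord (t : ℕ) :
    applyFlips (sortingWord t) (burntStack (21 + 4 * t)) = sortedStack (21 + 4 * t) := by
  -- `c i` is the `i`-th element of the central block, `y` lists the even numbers up to `2 * t`
  -- followed by `c 8`
  obtain ⟨c, hc⟩ : ∃ c : ℕ → ℤ, ∀ i, c i = 2 * t + i := ⟨_, fun _ => rfl⟩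
  obtain ⟨y, hy, hyt⟩ : ∃ y : ℕ → ℤ, (∀ j < t, y j = 2 * j + 2) ∧ y t = c 8 :=
    ⟨fun j => if j < t then 2 * j + 2 else c 8, fun j hj => by simp [hj], by simp⟩
  obtain ⟨f, hf⟩ : ∃ f : ℕ → ℤ, ∀ j, f j = 2 * j + 1 := ⟨_, fun _ => rfl⟩
  obtain ⟨g, hg⟩ : ∃ g : ℕ → ℤ, ∀ j, g j = -(20 + 2 * t + 2 * j) := ⟨_, fun _ => rfl⟩
  obtain ⟨h, hh⟩ : ∃ h : ℕ → ℤ, ∀ j, h j = -(21 + 2 * t + 2 * j) := ⟨_, fun _ => rfl⟩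
  obtain ⟨e, he⟩ : ∃ e : ℤ, e = 19 + 4 * t := ⟨_, rfl⟩
  obtain ⟨p, hp⟩ : ∃ p : ℤ, p = 20 + 4 * t := ⟨_, rfl⟩
  obtain ⟨q, hq⟩ : ∃ q : ℤ, q = 21 + 4 * t := ⟨_, rfl⟩
  have start : burntStack (21 + 4 * t) = (List.range t).flatMap (fun j => [-f j, -y j]) ++
      [-c 1, -c 2, -c 3, -c 4, -c 5, -c 6, -c 7, -c 8, -c 9, -c 10, -c 11, -c 12, -c 13, -c 14,
        -c 15, -c 16, -c 17, -c 18, -c 19] ++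
      (List.range t).flatMap (fun j => [g j, h j]) ++ [-p, -q] := by
    rw [burntStack_eq]
    refine congrArg₂ _ (congrArg₂ _ (congrArg₂ _ ?_ ?_) ?_) (by rw [hp, hq])
    · exact flatMap_range_congr fun j hj => by rw [hf, hy j hj]
    · simp [List.range_succ, hc]
    · exact flatMap_range_congr fun j _ => by rw [hg, hh]
  have finish : sortedStack (21 + 4 * t) =
      [f 0] ++ (List.range t).flatMap (fun j => [y j, f (j + 1)]) ++
      [c 2, c 3, c 4, c 5, c 6, c 7, c 8, c 9, c 10, c 11, c 12, c 13, c 14, c 15, c 16, c 17,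
        c 18] ++
      (List.range t).flatMap (fun j => [-(h j + 2), -g j]) ++ [e, p, q] := by
    rw [sortedStack_eq]
    refine congrArg₂ _ (congrArg₂ _ (congrArg₂ _ (congrArg₂ _ ?_ ?_) ?_) ?_) (by rw [he, hp, hq])
    · simp [hf]
    · exact flatMap_range_congr fun j hj => by simp [hf, hy j hj]; ring
    · simp [List.range_succ, hc]
    · exact flatMap_range_congr fun j _ => by simp [hg, hh]; ring
  have hlen := fun a b c d : ℕ → ℤ =>
    length_flatMap_range (fun j => [a j, b j, c j, d j]) 4 (fun _ => rfl) t
  have hlen₂ := fun a b : ℕ → ℤ => length_flatMap_range (fun j => [a j, b j]) 2 (fun _ => rfl) t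
  have e₁ := applyFlips_interleave [-c 1, -c 2, -c 3, -c 4, -c 5, -c 6, -c 7, -c 8, -c 9, -c 10, -c
    11, -c 12, -c 13, -c 14, -c 15, -c 16, -c 17, -c 18, -c 19] [-p, -q] (fun j => -f j) (fun j =>
    -y j) g h (2 * t + 17) t 0 [] rfl (by simp; ring)
  have e₂ := cut_blocks t (c 1) (c 2) (c 3) (c 4) (c 5) (c 6) (c 7) (c 8) (c 9) (c 10) (c 11) (c 12)
    (c 13) (c 14) (c 15) (c 16) (c 17) (c 18) (c 19) p q _ (hlen y f g h)
  have r₃ := flatMap_range_rotate (fun j => [y j]) (fun j => [f j, g j, h j]) t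
  have e₃ := fun W => applyFlips_nest (fun j => [f j, g j, h j, y (j + 1)]) (fun _ => rfl) W 8 0 t
    ([c 17, c 16, -c 13, -c 14, -c 15, -c 18, -c 19] ++ [y 0]) rfl
  have e₄ := move_nest t (c 7) (c 6) (c 5) (c 12) (c 11) (c 10) (c 9) (c 4) (c 3) (c 2) (c 1) p q
    (nest (fun j => [f j, g j, h j, y (j + 1)]) 0 t ([c 17, c 16, -c 13, -c 14, -c 15, -c 18, -c 19]
    ++ [y 0])) (by rw [length_nest _ (fun _ => rfl)]; simp; ring)
  have e₅ := fun W => applyFlips_unnest f g h (fun j => y (j + 1)) W 8 0 t ([c 17, c 16, -c 13, -c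
    14, -c 15, -c 18, -c 19] ++ [y 0]) rfl
  have r₆ := flatMap_range_rotate (fun j => [y j]) (fun j => [f (j + 1), g (j + 1), h j]) t
  have e₆ := sweep_front (-g 0) (f 0) (c 17) (c 16) (c 13) (c 14) (c 15) (c 18) (c 19) (c 8) (c 9)
    (c 4) (c 3) (c 2) (c 10) (c 11) (c 12) (c 5) (c 6) (c 7) q ((List.range t).flatMap fun j => [y
    j, f (j + 1), g (j + 1), h j])
  have r₇ := flatMap_range_rotate (fun j => [g j, h j + 2]) (fun j => [y j, f (j + 1)]) t
  have e₇ := gather_ends t (c 14) (c 13) (c 16) (c 15) (c 18) (c 17) (f 0) p e (c 8) (c 9) (c 4)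
    (c 3) (c 2) (c 10) (c 11) (c 12) (c 5) (c 6) (c 7) q _ (hlen g (fun j => h j + 2) y fun j => f
    (j + 1))
  have e₈ := applyFlips_unzip g (fun j => h j + 2) y (fun j => f (j + 1)) (2 * t + 17) t [e, p, q, c
    7, c 8, c 9, c 4, c 3, c 6, c 5, c 12, c 11, c 14, c 13, -c 16, -c 15, -c 18, -c 17, f 0] [c 2,
    -c 10] (by simp; ring)
  have e₉ := merge_blocks t e p q (c 7) (c 8) (c 9) (c 4) (c 3) (c 6) (c 5) (c 12) (c 11) (c 14)
    (c 13) (c 16) (c 15) (c 18) (c 17) (f 0) (c 2) (c 10) _ _ (hlen₂ (fun j => -(h j + 2)) fun j =>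
    -g j) (hlen₂ y fun j => f (j + 1))
  have hh' (j : ℕ) : h (j + 1) + 2 = h j := by rw [hh, hh]; push_cast; ring
  have hh₀ : h 0 + 2 = -c 19 := by rw [hh, hc]; push_cast; ring
  have hht : h t + 2 = -e := by rw [hh, he]; ring
  have hgt : g t = -p := by rw [hg, hp]; ring
  have hft : f t = c 1 := by rw [hf, hc]; push_cast; ring
  rw [sortingWord, start, finish]
  simp only [applyFlips_append]
  simp only [← List.range_eq_range', List.cons_append, List.nil_append, List.append_assoc, hyt,
    zero_add, neg_neg, hh', hh₀, hht, hgt, hft]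
    at e₁ e₂ r₃ e₃ e₄ e₅ r₆ e₆ r₇ e₇ e₈ e₉ ⊢
  rw [e₁, e₂, r₃, e₃, e₄, e₅, ← r₆, e₆, ← r₇, e₇, e₈, e₉]

/-- For every integer `n ≥ 37` with `n ≡ 1 (mod 12)`, there exists a sequence of flips of
length exactly `(3n+3)/2` transforming `Ī_n` into `I_n`. -/
theorem exists_sorting_seq_one_mod_twelve (n : ℕ) (hn : 37 ≤ n) (hmod : n % 12 = 1) :
    ∃ ks : List ℕ, IsSortingSeq n ks ∧ ks.length = (3 * n + 3) / 2 := by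
  obtain ⟨t, rfl⟩ : ∃ t, n = 21 + 4 * t := ⟨(n - 21) / 4, by omega⟩
  exact ⟨sortingWord t, ⟨fun _ => mem_sortingWord, applyFlips_sortingWord t⟩, by
    rw [length_sortingWord]; omega⟩
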